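/- Let n ≥ 2 and let I ⊆ {2,…,n} be any subset. Define the linear functional L_τ : ℝⁿ → ℝ by L_τ(x) = Σ_{i ∈ {2,…,n} \ I} x_i. Then L_τ(x) ≥ 0 for every x ∈ K(𝒮), and {x ∈ K(𝒮) : L_τ(x) = 0} equals the convex cone generated by {e₁} ∪ {e₁ + 2e_i : i ∈ I}. In particular, this cone is an exposed face of K(𝒮) of dimension |I| + 1. -/

import Mathlib

open scoped NNReal

noncomputable section

/-- `mvec n i j` is the exponent vector `m_{(i+1)(j+1)} = e₁ + ê_{i+1} + ê_{j+1}`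
(Lean index `t : Fin n` corresponds to the paper index `t+1`). -/
def mvec (n : ℕ) [NeZero n] (i j t : Fin n) : ℕ :=
  (if t = 0 then 1 else 0) + (if t = i ∧ i ≠ 0 then 1 else 0) +
    (if t = j ∧ j ≠ 0 then 1 else 0)

/-- The set `𝒜 = {m_{ij} : 1 ≤ i ≤ j ≤ n}` regarded inside `ℝⁿ`. -/
def AsetR (n : ℕ) [NeZero n] : Set (Fin n → ℝ) :=
  {v | ∃ i j : Fin n, i ≤ j ∧ v = fun t => (mvec n i j t : ℝ)}

/-- `rayVec n 0 = e₁` and `rayVec n i = e₁ + 2 e_{i+1}` for `i ≠ 0`. -/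
def rayVec (n : ℕ) [NeZero n] (i : Fin n) : Fin n → ℝ := fun t => (mvec n i i t : ℝ)

lemma rayVec_apply_zero (n : ℕ) [NeZero n] (i : Fin n) : rayVec n i 0 = 1 := by
  by_cases h : i = 0 <;> simp [rayVec, mvec, h, eq_comm]

lemma rayVec_apply_of_ne_zero (n : ℕ) [NeZero n] (i : Fin n) {t : Fin n} (ht : t ≠ 0) :
    rayVec n i t = if t = i then 2 else 0 := by
  by_cases h : t = i
  · subst h; simp [rayVec, mvec, ht]
  · simp [rayVec, mvec, ht, h]

lemma rayVec_mem_AsetR (n : ℕ) [NeZero n] (i : Fin n) : rayVec n i ∈ AsetR n :=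
  ⟨i, i, le_rfl, rfl⟩

lemma sum_mvec_le (n : ℕ) [NeZero n] (i j : Fin n) :
    ∑ t with t ≠ 0, (mvec n i j t : ℝ) ≤ 2 * mvec n i j 0 := by
  have h (i : Fin n) :
      ∑ t with t ≠ 0, (if t = i ∧ i ≠ 0 then 1 else 0 : ℕ) ≤ 1 := by
    rw [← Finset.card_filter, Finset.card_le_one]
    simp +contextual
  have h0 : ∑ t with t ≠ (0 : Fin n), (if t = 0 then 1 else 0 : ℕ) = 0 :=
    Finset.sum_eq_zero fun t ht => if_neg (Finset.mem_filter.1 ht).2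
  have hs : ∑ t with t ≠ 0, mvec n i j t ≤ 2 * 1 := by
    simp only [mvec, Finset.sum_add_distrib]
    linarith [h i, h j]
  have h1 : 1 ≤ mvec n i j 0 := by simp [mvec]; omega
  exact_mod_cast hs.trans (Nat.mul_le_mul_left 2 h1)

/-- Inequalities valid on `K(𝒮)`: all coordinates are nonnegative, and the coordinates other than
the first sum to at most twice the first. -/
lemma nonneg_and_sum_le_of_mem_span (n : ℕ) [NeZero n] {x : Fin n → ℝ}
    (hx : x ∈ Submodule.span ℝ≥0 (AsetR n)) :
    (∀ t, 0 ≤ x t) ∧ ∑ t with t ≠ 0, x t ≤ 2 * x 0 := by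
  induction hx using Submodule.span_induction with
  | mem x hx =>
    obtain ⟨i, j, -, rfl⟩ := hx
    exact ⟨fun t => Nat.cast_nonneg _, sum_mvec_le n i j⟩
  | zero => simp
  | add x y _ _ hx hy =>
    refine ⟨fun t => add_nonneg (hx.1 t) (hy.1 t), ?_⟩
    simp only [Pi.add_apply, Finset.sum_add_distrib]
    linarith [hx.2, hy.2]
  | smul a x _ hx =>
    refine ⟨fun t => mul_nonneg a.2 (hx.1 t), ?_⟩
    simp only [Pi.smul_apply, NNReal.smul_def, smul_eq_mul, ← Finset.mul_sum]
    linarith [mul_le_mul_of_nonneg_left hx.2 a.coe_nonneg]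

lemma smul_mem_span_nnreal {E : Type*} [AddCommMonoid E] [Module ℝ E] {s : Set E} {v : E}
    (hv : v ∈ s) {a : ℝ} (ha : 0 ≤ a) : a • v ∈ Submodule.span ℝ≥0 s :=
  Submodule.smul_mem _ (⟨a, ha⟩ : ℝ≥0) (Submodule.subset_span hv)

lemma mem_span_rayVec (n : ℕ) [NeZero n] {I : Finset (Fin n)} (hI : (0 : Fin n) ∉ I)
    {x : Fin n → ℝ} (hx : ∀ t, 0 ≤ x t) (hle : ∑ t with t ≠ 0, x t ≤ 2 * x 0)
    (hz : ∀ t, t ≠ 0 → t ∉ I → x t = 0) :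
    x ∈ Submodule.span ℝ≥0 (insert (rayVec n 0) (rayVec n '' (I : Set (Fin n)))) := by
  have hsub : ∑ i ∈ I, x i ≤ ∑ t with t ≠ 0, x t :=
    Finset.sum_le_sum_of_subset_of_nonneg
      (fun i hi => by simpa using ne_of_mem_of_not_mem hi hI) fun t _ _ => hx t
  have key : x = (x 0 - ∑ i ∈ I, x i / 2) • rayVec n 0 + ∑ i ∈ I, (x i / 2) • rayVec n i := by
    funext t
    simp only [Pi.add_apply, Pi.smul_apply, smul_eq_mul, Finset.sum_apply]
    by_cases ht : t = 0
    · subst ht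
      simp [rayVec_apply_zero]
    · by_cases htI : t ∈ I
      · simp [rayVec_apply_of_ne_zero n _ ht, ht, htI]
      · simp [rayVec_apply_of_ne_zero n _ ht, ht, htI, hz t ht htI]
  rw [key]
  refine add_mem (smul_mem_span_nnreal (Set.mem_insert _ _) ?_)
    (sum_mem fun i hi => smul_mem_span_nnreal
      (Set.mem_insert_of_mem _ (Set.mem_image_of_mem _ hi)) (div_nonneg (hx i) zero_le_two))
  rw [← Finset.sum_div]
  linarith

lemma linearIndependent_rayVec (n : ℕ) [NeZero n] : LinearIndependent ℝ (rayVec n) := by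
  rw [Fintype.linearIndependent_iff]
  intro g hg
  have hne (t : Fin n) (ht : t ≠ 0) : g t = 0 := by
    simpa [rayVec_apply_of_ne_zero n _ ht] using congrFun hg t
  have h0 := congrFun hg 0
  simp only [Finset.sum_apply, Pi.smul_apply, smul_eq_mul, rayVec_apply_zero, mul_one,
    Pi.zero_apply] at h0
  rw [Finset.sum_eq_single 0 (fun t _ ht => hne t ht) (by simp)] at h0
  intro i
  by_cases hi : i = 0
  · exact hi ▸ h0
  · exact hne i hi

lemma finrank_span_rayVec_image (n : ℕ) [NeZero n] (J : Finset (Fin n)) :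
    Module.finrank ℝ (Submodule.span ℝ (rayVec n '' (J : Set (Fin n)))) = J.card := by
  have h := finrank_span_eq_card
    ((linearIndependent_rayVec n).comp ((↑) : J → Fin n) Subtype.val_injective)
  rw [Set.range_comp, Subtype.range_coe_subtype] at h
  simpa using h

/-- for any subset `I ⊆ {2,…,n}` (encoded as `I : Finset (Fin n)` with
`0 ∉ I`), the linear functional `L_τ(x) = Σ_{i ∈ {2,…,n} \ I} x_i` is nonnegative on
`K(𝒮)`, its zero locus in `K(𝒮)` is the cone generated by `{e₁} ∪ {e₁ + 2e_i : i ∈ I}`,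
and this exposed face has dimension `|I| + 1`. -/
theorem exposed_face_with_e1 (n : ℕ) [NeZero n] (hn : 2 ≤ n)
    (I : Finset (Fin n)) (hI : (0 : Fin n) ∉ I) :
    (∀ x ∈ Submodule.span ℝ≥0 (AsetR n),
        0 ≤ ∑ t ∈ Finset.univ.filter (fun t => t ≠ (0 : Fin n) ∧ t ∉ I), x t) ∧
      {x : Fin n → ℝ | x ∈ Submodule.span ℝ≥0 (AsetR n) ∧
          ∑ t ∈ Finset.univ.filter (fun t => t ≠ (0 : Fin n) ∧ t ∉ I), x t = 0} =
        ↑(Submodule.span ℝ≥0 (insert (rayVec n 0) (rayVec n '' ↑I))) ∧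
      Module.finrank ℝ
          ↥(Submodule.span ℝ (insert (rayVec n 0) (rayVec n '' ↑I))) = I.card + 1 := by
  refine ⟨fun x hx => Finset.sum_nonneg fun t _ => (nonneg_and_sum_le_of_mem_span n hx).1 t, ?_, ?_⟩
  · ext x
    constructor
    · rintro ⟨hx, hL⟩
      obtain ⟨hpos, hle⟩ := nonneg_and_sum_le_of_mem_span n hx
      rw [Finset.sum_eq_zero_iff_of_nonneg fun t _ => hpos t] at hL
      exact mem_span_rayVec n hI hpos hle fun t ht htI => hL t (by simp [ht, htI])
    · intro hx
      refine ⟨Submodule.span_mono ?_ hx, Finset.sum_eq_zero fun t ht => ?_⟩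
      · rintro _ (rfl | ⟨i, -, rfl⟩) <;> exact rayVec_mem_AsetR n _
      · obtain ⟨ht0, htI⟩ := (Finset.mem_filter.1 ht).2
        have hle : Submodule.span ℝ≥0 (insert (rayVec n 0) (rayVec n '' (I : Set (Fin n)))) ≤
            LinearMap.ker (LinearMap.proj t : (Fin n → ℝ) →ₗ[ℝ≥0] ℝ) := by
          rw [Submodule.span_le]
          rintro _ (rfl | ⟨i, hi, rfl⟩)
          · simp [rayVec_apply_of_ne_zero n _ ht0, ht0]
          · simp [rayVec_apply_of_ne_zero n _ ht0, (ne_of_mem_of_not_mem hi htI).symm]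
        exact hle hx
  · rw [← Set.image_insert_eq, ← Finset.coe_insert, finrank_span_rayVec_image,
      Finset.card_insert_of_notMem hI]

end
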